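/- In the correlated stochastic block model, fix ε ∈ (0,1) and suppose n·s²·(p+(k−1)q)/k < (1−ε)·log n and p·s² = o(1). Then there exist constants δ > γ > 0 such that, if k = o(n^{δ−γ}), then min over all permutations π of [n] of P_π( |T_r^π| ≥ n^γ/2 for some r ∈ [k] ) → 1 as n → ∞, where P_π denotes the law of the model conditioned on π_* = π and T_r^π = T^π ∩ V_r with T^π = {i ∈ [n] : A_{i,j}·B_{π(i),π(j)} = 0 for all j ∈ [n]}. -/

import Mathlib

open Finset Filter

namespace CSBM

/-- Unordered pairs of distinct vertices of `[n]`, encoded as ordered pairs `(i,j)` with `i < j`. -/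
abbrev Edge (n : ℕ) := {e : Fin n × Fin n // e.1 < e.2}

/-- Bernoulli weight: probability of outcome `b` under a `Bernoulli(p)` variable. -/
noncomputable def bern (p : ℝ) (b : Bool) : ℝ := if b then p else 1 - p

/-- Edge indicator between two vertices for a graph encoded on ordered pairs `i < j`. -/
def adj {n : ℕ} (g : Edge n → Bool) (i j : Fin n) : Bool :=
  if h : i < j then g ⟨(i, j), h⟩ else if h' : j < i then g ⟨(j, i), h'⟩ else false

/-- The lifted permutation `ℓ(π)` acting on unordered pairs. -/
def lift {n : ℕ} (π : Equiv.Perm (Fin n)) (e : Edge n) : Edge n :=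
  if h : π e.1.1 < π e.1.2 then ⟨(π e.1.1, π e.1.2), h⟩
  else ⟨(π e.1.2, π e.1.1),
    lt_of_le_of_ne (not_lt.mp h) fun hc => e.2.ne' (π.injective hc)⟩

/-- Outcome of the correlated SBM: community labels, parent graph, and two subsampling masks. -/
abbrev Omega (n k : ℕ) := (Fin n → Fin k) × (Edge n → Bool) × (Edge n → Bool) × (Edge n → Bool)

/-- Joint density (probability mass) of `CSBM(n,p,q,k,s)`: labels i.i.d. uniform on `[k]`,
parent edges Bernoulli `p`/`q` according to labels, two independent `s`-subsampling masks. -/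
noncomputable def density (n k : ℕ) (p q s : ℝ) (ω : Omega n k) : ℝ :=
  ((k : ℝ))⁻¹ ^ n
    * (∏ e : Edge n, bern (if ω.1 e.1.1 = ω.1 e.1.2 then p else q) (ω.2.1 e))
    * (∏ e : Edge n, bern s (ω.2.2.1 e))
    * (∏ e : Edge n, bern s (ω.2.2.2 e))

/-- Probability of an event under `CSBM(n,p,q,k,s)` (with the ground-truth permutation being
a fixed parameter, entering only through observables). -/
noncomputable def Pr (n k : ℕ) (p q s : ℝ) (A : Set (Omega n k)) : ℝ :=
  ∑ ω : Omega n k, Set.indicator A (density n k p q s) ω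

/-- Adjacency matrix of `G₁` (first subsample of the parent graph). -/
def G1adj {n k : ℕ} (ω : Omega n k) : Fin n → Fin n → Bool :=
  fun i j => adj ω.2.1 i j && adj ω.2.2.1 i j

/-- Adjacency matrix of `G₂'` (second subsample of the parent graph, unpermuted). -/
def G2primeAdj {n k : ℕ} (ω : Omega n k) : Fin n → Fin n → Bool :=
  fun i j => adj ω.2.1 i j && adj ω.2.2.2 i j

/-- Adjacency matrix of `G₂`: the second subsample with vertices relabeled by `π`. -/
def G2adj {n k : ℕ} (π : Equiv.Perm (Fin n)) (ω : Omega n k) : Fin n → Fin n → Bool :=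
  fun i j => G2primeAdj ω (π.symm i) (π.symm j)

/-- Alignment score `Σ_{i<j} A_{i,j} B_{π(i),π(j)}`. -/
def align {n : ℕ} (A B : Fin n → Fin n → Bool) (π : Equiv.Perm (Fin n)) : ℕ :=
  ∑ e : Edge n, (if A e.1.1 e.1.2 && B (π e.1.1) (π e.1.2) then 1 else 0)


/-- `T^π`: vertices isolated in the intersection of `a` with the `π`-aligned `b`. -/
def Tset {n : ℕ} (a b : Fin n → Fin n → Bool) (π : Equiv.Perm (Fin n)) : Finset (Fin n) :=
  univ.filter fun i => ∀ j, (a i j && b (π i) (π j)) = false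

/-- `|T_r^π| = |T^π ∩ V_r|`. -/
def TrCard {n k : ℕ} (σ₀ : Fin n → Fin k) (a b : Fin n → Fin n → Bool)
    (π : Equiv.Perm (Fin n)) (r : Fin k) : ℕ :=
  (Tset a b π ∩ univ.filter fun i => σ₀ i = r).card


/-- Expectation. -/
noncomputable def EE (n k : ℕ) (p q s : ℝ) (F : Omega n k → ℝ) : ℝ :=
  ∑ ω : Omega n k, density n k p q s ω * F ω

/-- No common edge on `e`. -/
def nb {n k : ℕ} (ω : Omega n k) (e : Edge n) : ℝ :=
  if ω.2.1 e && ω.2.2.1 e && ω.2.2.2 e then 0 else 1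

/-- Edge touches vertex. -/
def tch {n : ℕ} (i : Fin n) (e : Edge n) : Prop := e.1.1 = i ∨ e.1.2 = i

instance {n : ℕ} (i : Fin n) (e : Edge n) : Decidable (tch i e) := by unfold tch; infer_instance

/-- Isolation indicator. -/
def ind {n k : ℕ} (i : Fin n) (ω : Omega n k) : ℝ := ∏ e : Edge n, if tch i e then nb ω e else 1

/-- Connection kernel. -/
def ff {k : ℕ} (a b : ℝ) (x y : Fin k) : ℝ := if x = y then a else b

lemma density_nonneg {n k : ℕ} {p q s : ℝ} (hp : p ∈ Set.Icc (0 : ℝ) 1) (hq : q ∈ Set.Icc (0 : ℝ) 1)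
    (hs : s ∈ Set.Icc (0 : ℝ) 1) (ω : Omega n k) : 0 ≤ density n k p q s ω := by
  have hb : ∀ t ∈ Set.Icc (0 : ℝ) 1, ∀ b, 0 ≤ bern t b := by
    intro t ht b; unfold bern; split_ifs <;> linarith [ht.1, ht.2]
  unfold density
  refine mul_nonneg (mul_nonneg (mul_nonneg (by positivity) ?_) ?_) ?_ <;>
    refine prod_nonneg fun e _ => hb _ ?_ _
  · split_ifs <;> assumption
  · exact hs
  · exact hs

lemma sum3 {E : Type*} [Fintype E] [DecidableEq E] (h : E → Bool → Bool → Bool → ℝ) :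
    ∑ x : (E → Bool) × (E → Bool) × (E → Bool), ∏ e, h e (x.1 e) (x.2.1 e) (x.2.2 e)
      = ∏ e, ∑ x, ∑ y, ∑ z, h e x y z := by
  simp only [Fintype.sum_prod_type]
  rw [Fintype.prod_sum]
  refine sum_congr rfl fun g _ => ?_
  rw [Fintype.prod_sum]
  refine sum_congr rfl fun g _ => ?_
  rw [Fintype.prod_sum]

lemma EE_prod {n k : ℕ} (p q s : ℝ) (S : Edge n → Prop) [DecidablePred S] :
    EE n k p q s (fun ω => ∏ e, if S e then nb ω e else 1)
      = ((k : ℝ))⁻¹ ^ n * ∑ σ : Fin n → Fin k,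
        ∏ e : Edge n, if S e then ff (1 - p * s ^ 2) (1 - q * s ^ 2) (σ e.1.1) (σ e.1.2) else 1 := by
  unfold EE
  rw [Fintype.sum_prod_type, mul_sum]
  refine sum_congr rfl fun σ _ => ?_
  have := sum3 (E := Edge n) (fun e x y z => bern (if σ e.1.1 = σ e.1.2 then p else q) x * bern s y *
     bern s z * (if S e then (if x && y && z then 0 else 1) else 1))
  have h2 : ∀ e : Edge n, (∑ x, ∑ y, ∑ z, bern (if σ e.1.1 = σ e.1.2 then p else q) x * bern s y *
     bern s z * (if S e then (if x && y && z then 0 else 1) else 1))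
      = if S e then ff (1 - p * s ^ 2) (1 - q * s ^ 2) (σ e.1.1) (σ e.1.2) else 1 := by
    intro e
    unfold ff bern
    split_ifs <;> simp <;> ring
  rw [← prod_congr rfl fun e _ => h2 e, ← this, mul_sum]
  refine sum_congr rfl fun x _ => ?_
  unfold density nb
  simp only [prod_mul_distrib]
  ring

lemma EE_one {n k : ℕ} (hk : 1 ≤ k) (p q s : ℝ) : EE n k p q s (fun _ => 1) = 1 := by
  have := EE_prod (n := n) (k := k) p q s (fun _ => False)
  simp at this
  rw [this]
  have : (k : ℝ) ≠ 0 := by positivity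
  field_simp

lemma prod_tch {n : ℕ} (i : Fin n) (F : Fin n → Fin n → ℝ) (hF : ∀ x y, F x y = F y x) :
    (∏ e : Edge n, if tch i e then F e.1.1 e.1.2 else 1) = ∏ l ∈ univ.erase i, F i l := by
  rw [← prod_filter]
  refine prod_bij' (fun e _ => if e.1.1 = i then e.1.2 else e.1.1)
    (fun l hl => if h : i < l then ⟨(i, l), h⟩ else
      if h' : l < i then ⟨(l, i), h'⟩ else False.elim (by simp at hl; omega)) ?_ ?_ ?_ ?_ ?_
  · rintro ⟨⟨x, y⟩, h⟩ he
    simp only [mem_filter, mem_univ, true_and, mem_erase, and_true] at he h ⊢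
    unfold tch at he
    dsimp only at he
    split_ifs <;> grind
  · intro l hl
    simp only [mem_filter, mem_univ, true_and, mem_erase, and_true] at hl ⊢
    unfold tch
    split_ifs <;> first | simp | omega
  · rintro ⟨⟨x, y⟩, h⟩ he
    simp only [mem_filter, mem_univ, true_and] at he h ⊢
    unfold tch at he
    dsimp only at he
    rcases he with rfl | rfl
    · simp [h]
    · simp [h, h.ne, not_lt.2 h.le]
  · intro l hl
    simp at hl
    rcases lt_trichotomy i l with h | h | h
    · simp [h]
    · omega
    · simp [h, not_lt.2 h.le, h.ne]
  · rintro ⟨⟨x, y⟩, h⟩ he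
    simp only [mem_filter, mem_univ, true_and] at he h ⊢
    unfold tch at he
    dsimp only at he
    rcases he with rfl | rfl
    · simp
    · simp [h.ne, hF]

lemma ff_symm {k : ℕ} (a b : ℝ) (x y : Fin k) : ff a b x y = ff a b y x := by
  unfold ff; simp [eq_comm]

lemma sum_ff {k : ℕ} (a b : ℝ) (r : Fin k) :
    ∑ x, ff a b r x = a + ((k : ℝ) - 1) * b := by
  have : ∀ x, ff a b r x = b + if r = x then a - b else 0 := by
    intro x; unfold ff; split_ifs <;> ring
  simp_rw [this, sum_add_distrib]
  simp
  ring

lemma sum_ff_sq {k : ℕ} (a b : ℝ) (r : Fin k) :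
    ∑ x, ff a b r x ^ 2 = a ^ 2 + ((k : ℝ) - 1) * b ^ 2 := by
  rw [← sum_ff _ _ r]
  refine sum_congr rfl fun x _ => ?_
  unfold ff; split_ifs <;> rfl

lemma EE_ind {n k : ℕ} (hk : 1 ≤ k) (p q s : ℝ) (i : Fin n) :
    EE n k p q s (ind i) = (((1 - p * s ^ 2) + ((k : ℝ) - 1) * (1 - q * s ^ 2)) / k) ^ (n - 1) := by
  unfold ind
  rw [EE_prod]
  set a := 1 - p * s ^ 2
  set b := 1 - q * s ^ 2
  have h1 : ∀ σ : Fin n → Fin k, (∏ e : Edge n, if tch i e then ff a b (σ e.1.1) (σ e.1.2) else 1)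
      = ∑ r, ∏ l, (if l = i then (if σ l = r then 1 else 0) else ff a b r (σ l)) := by
    intro σ
    rw [prod_tch i (fun x y => ff a b (σ x) (σ y)) (fun x y => ff_symm _ _ _ _)]
    rw [sum_eq_single (σ i)]
    · rw [← mul_prod_erase univ _ (mem_univ i)]
      simp
      refine prod_congr rfl fun l hl => ?_
      simp at hl; simp [hl]
    · intro r _ hr
      exact prod_eq_zero (mem_univ i) (by simp [hr.symm])
    · simp
  simp_rw [h1]
  rw [sum_comm]
  have h2 : ∀ r : Fin k, (∑ σ : Fin n → Fin k, ∏ l, (if l = i then (if σ l = r then (1 : ℝ) else 0) else ff a b r (σ l)))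
     = (a + ((k : ℝ) - 1) * b) ^ (n - 1) := by
    intro r
    rw [← Fintype.prod_sum (fun l x => (if l = i then (if x = r then (1 : ℝ) else 0) else ff a b r x))]
    rw [← mul_prod_erase univ _ (mem_univ i)]
    simp only [if_true, sum_ite_eq', mem_univ, one_mul]
    have : ∀ l ∈ univ.erase i, (∑ x : Fin k, (if l = i then (if x = r then (1 : ℝ) else 0) else ff a b r x)) = a + ((k : ℝ) - 1) * b := by
      intro l hl
      simp at hl
      simp only [hl, if_false, sum_ff]
    rw [prod_congr rfl this]; simp
  simp_rw [h2]
  have : (k : ℝ) ≠ 0 := by positivity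
  obtain ⟨m, rfl⟩ : ∃ m, n = m + 1 := ⟨n - 1, by have := i.2; omega⟩
  simp [div_pow]
  field_simp
  ring

lemma EE_mono {n k : ℕ} {p q s : ℝ} (hp : p ∈ Set.Icc (0 : ℝ) 1) (hq : q ∈ Set.Icc (0 : ℝ) 1)
    (hs : s ∈ Set.Icc (0 : ℝ) 1) {F G : Omega n k → ℝ} (h : ∀ ω, F ω ≤ G ω) :
    EE n k p q s F ≤ EE n k p q s G :=
  sum_le_sum fun ω _ => mul_le_mul_of_nonneg_left (h ω) (density_nonneg hp hq hs ω)

lemma pair_le {n k : ℕ} {a b : ℝ} (ha : a ∈ Set.Icc (0 : ℝ) 1) (hb : b ∈ Set.Icc (0 : ℝ) 1)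
    (i j : Fin n) (hij : i ≠ j) (σ : Fin n → Fin k) :
    (∏ e : Edge n, if tch i e ∨ tch j e then ff a b (σ e.1.1) (σ e.1.2) else 1)
      ≤ ∏ l ∈ (univ.erase i).erase j, ff a b (σ i) (σ l) * ff a b (σ j) (σ l) := by
  have hf : ∀ x y : Fin k, 0 ≤ ff a b x y ∧ ff a b x y ≤ 1 := by
    intro x y; unfold ff; split_ifs; exacts [ha, hb]
  set F : Fin n → Fin n → ℝ := fun x y =>
    if (x = i ∧ y = j) ∨ (x = j ∧ y = i) then 1 else ff a b (σ x) (σ y) with hFdef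
  have hsymm : ∀ x y, F x y = F y x := by
    intro x y
    simp only [hFdef]
    rw [ff_symm]
    congr 1
    apply propext; tauto
  have hle : (∏ e : Edge n, if tch i e ∨ tch j e then ff a b (σ e.1.1) (σ e.1.2) else 1)
     ≤ ∏ e : Edge n, ((if tch i e then F e.1.1 e.1.2 else 1) * (if tch j e then F e.1.1 e.1.2 else 1)) := by
    refine prod_le_prod ?_ ?_
    · intro e _; split_ifs; exacts [(hf _ _).1, zero_le_one]
    · rintro ⟨⟨x, y⟩, h⟩ _
      simp only [tch, hFdef]
      have := (hf (σ x) (σ y)).2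
      simp only at h
      split_ifs <;> simp_all <;> grind
  refine hle.trans (le_of_eq ?_)
  rw [prod_mul_distrib, prod_tch i F hsymm, prod_tch j F hsymm, prod_mul_distrib]
  rw [← mul_prod_erase (univ.erase i) _ (a := j) (by simp [hij.symm]),
    ← mul_prod_erase (univ.erase j) _ (a := i) (by simp [hij]), erase_right_comm (a := j)]
  have e1 : F i j = 1 := by simp [hFdef]
  have e2 : F j i = 1 := by simp [hFdef]
  rw [e1, e2, one_mul, one_mul]
  congr 1 <;> refine prod_congr rfl fun l hl => ?_ <;> simp at hl <;> simp [hFdef, hl]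

lemma EE_pair {n k : ℕ} (hk : 1 ≤ k) {p q s : ℝ} (hp : p ∈ Set.Icc (0 : ℝ) 1)
    (hq : q ∈ Set.Icc (0 : ℝ) 1) (hs : s ∈ Set.Icc (0 : ℝ) 1) (i j : Fin n) (hij : i ≠ j) :
    EE n k p q s (fun ω => ind i ω * ind j ω)
      ≤ (((1 - p * s ^ 2) ^ 2 + ((k : ℝ) - 1) * (1 - q * s ^ 2) ^ 2) / k) ^ (n - 2) := by
  have hs2 : s ^ 2 ∈ Set.Icc (0 : ℝ) 1 := ⟨sq_nonneg _, pow_le_one₀ hs.1 hs.2⟩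
  have ha : 1 - p * s ^ 2 ∈ Set.Icc (0 : ℝ) 1 :=
    ⟨by nlinarith [hp.1, hp.2, hs2.1, hs2.2], by nlinarith [hp.1, hs2.1]⟩
  have hb : 1 - q * s ^ 2 ∈ Set.Icc (0 : ℝ) 1 :=
    ⟨by nlinarith [hq.1, hq.2, hs2.1, hs2.2], by nlinarith [hq.1, hs2.1]⟩
  have h0 : EE n k p q s (fun ω => ind i ω * ind j ω) =
      EE n k p q s (fun ω => ∏ e, if tch i e ∨ tch j e then nb ω e else 1) := by
    congr 1
    funext ω
    unfold ind
    rw [← prod_mul_distrib]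
    refine prod_congr rfl fun e _ => ?_
    unfold nb
    split_ifs <;> simp_all
  rw [h0, EE_prod]
  set a := 1 - p * s ^ 2
  set b := 1 - q * s ^ 2
  have hf : ∀ x y : Fin k, 0 ≤ ff a b x y := by
    intro x y; unfold ff; split_ifs; exacts [ha.1, hb.1]
  set G : Fin k → Fin k → Fin n → Fin k → ℝ := fun r r' l x =>
    if l = i then (if x = r then 1 else 0) else if l = j then (if x = r' then 1 else 0)
      else ff a b r x * ff a b r' x with hG
  have h1 : ∀ σ : Fin n → Fin k, (∏ l ∈ (univ.erase i).erase j, ff a b (σ i) (σ l) * ff a b (σ j) (σ l))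
      = ∑ r, ∑ r', ∏ l, G r r' l (σ l) := by
    intro σ
    rw [sum_eq_single (σ i), sum_eq_single (σ j)]
    · rw [← mul_prod_erase univ _ (mem_univ i),
        ← mul_prod_erase (univ.erase i) _ (a := j) (by simp [hij.symm])]
      simp only [hG]
      simp [hij.symm]
      refine prod_congr rfl fun l hl => ?_
      simp at hl; simp [hl]
    · intro r _ hr
      exact prod_eq_zero (mem_univ j) (by simp [hG, hr.symm, hij.symm])
    · simp
    · intro r _ hr
      exact sum_eq_zero fun r' _ => prod_eq_zero (mem_univ i) (by simp [hG, hr.symm])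
    · simp
  have h2 : ∀ r r' : Fin k, (∑ σ : Fin n → Fin k, ∏ l, G r r' l (σ l))
     ≤ (a ^ 2 + ((k : ℝ) - 1) * b ^ 2) ^ (n - 2) := by
    intro r r'
    rw [← Fintype.prod_sum (fun l x => G r r' l x)]
    rw [← mul_prod_erase univ _ (mem_univ i),
        ← mul_prod_erase (univ.erase i) _ (a := j) (by simp [hij.symm])]
    have e1 : ∑ x, G r r' i x = 1 := by simp [hG]
    have e2 : ∑ x, G r r' j x = 1 := by simp [hG, hij.symm]
    rw [e1, e2, one_mul, one_mul]
    have : ∀ l ∈ (univ.erase i).erase j, (∑ x : Fin k, G r r' l x) ≤ a ^ 2 + ((k : ℝ) - 1) * b ^ 2 := by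
      intro l hl
      simp at hl
      simp only [hG, hl, if_false]
      have u1 := sum_ff_sq a b r
      have u2 := sum_ff_sq a b r'
      have : ∑ x, ff a b r x * ff a b r' x ≤ ∑ x, (ff a b r x ^ 2 + ff a b r' x ^ 2) / 2 :=
        sum_le_sum fun x _ => by nlinarith [sq_nonneg (ff a b r x - ff a b r' x)]
      rw [← sum_div, sum_add_distrib, u1, u2] at this
      linarith
    refine (prod_le_prod ?_ this).trans (le_of_eq ?_)
    · intro l hl
      simp at hl
      simp only [hG, hl, if_false]
      exact sum_nonneg fun x _ => mul_nonneg (hf _ _) (hf _ _)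
    · rw [prod_const]
      congr 1
      rw [card_erase_of_mem (by simp [hij.symm]), card_erase_of_mem (mem_univ _)]
      simp; omega
  have h3 : ∑ σ : Fin n → Fin k, (∏ e : Edge n, if tch i e ∨ tch j e then ff a b (σ e.1.1) (σ e.1.2) else 1)
     ≤ k * (k * (a ^ 2 + ((k : ℝ) - 1) * b ^ 2) ^ (n - 2)) := by
    calc _ ≤ ∑ σ : Fin n → Fin k, ∑ r, ∑ r', ∏ l, G r r' l (σ l) :=
          sum_le_sum fun σ _ => (pair_le ha hb i j hij σ).trans (h1 σ).le
      _ = ∑ r, ∑ r', ∑ σ : Fin n → Fin k, ∏ l, G r r' l (σ l) := by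
          rw [sum_comm]; exact sum_congr rfl fun r _ => sum_comm
      _ ≤ ∑ r : Fin k, ∑ r' : Fin k, (a ^ 2 + ((k : ℝ) - 1) * b ^ 2) ^ (n - 2) :=
          sum_le_sum fun r _ => sum_le_sum fun r' _ => h2 r r'
      _ = _ := by simp
  refine (mul_le_mul_of_nonneg_left h3 (by positivity)).trans (le_of_eq ?_)
  have : (k : ℝ) ≠ 0 := by positivity
  obtain ⟨m, rfl⟩ : ∃ m, n = m + 2 := ⟨n - 2, by
    have := i.2; have := j.2; have : (i : ℕ) ≠ j := fun h => hij (Fin.ext h); omega⟩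
  simp [div_pow]
  field_simp
  ring

lemma nb_eq {n k : ℕ} (i : Fin n) (ω : Omega n k) (π : Equiv.Perm (Fin n)) :
    ind i ω = if i ∈ Tset (G1adj ω) (G2adj π ω) π then 1 else 0 := by
  have hval : ∀ i j, (G1adj ω i j && G2adj π ω (π i) (π j)) =
      (adj ω.2.1 i j && adj ω.2.2.1 i j && adj ω.2.2.2 i j) := by
    intro i j
    simp only [G1adj, G2adj, G2primeAdj, Equiv.symm_apply_apply]
    cases adj ω.2.1 i j <;> simp
  have hs : ∀ (g : Edge n → Bool) x y, adj g x y = adj g y x := by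
    intro g x y
    unfold adj
    rcases lt_trichotomy x y with h | h | h
    · simp [h, not_lt.2 h.le]
    · simp [h]
    · simp [h, not_lt.2 h.le]
  set F : Fin n → Fin n → ℝ := fun x y =>
    if adj ω.2.1 x y && adj ω.2.2.1 x y && adj ω.2.2.2 x y then 0 else 1 with hF
  have hFs : ∀ x y, F x y = F y x := by
    intro x y; simp only [hF, hs _ x y]
  have h1 : ind i ω = ∏ l ∈ univ.erase i, F i l := by
    rw [← prod_tch i F hFs]
    unfold ind
    refine prod_congr rfl ?_
    rintro ⟨⟨x, y⟩, h⟩ _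
    simp only at h
    simp only [hF, nb, adj, h, dif_pos]
  rw [h1]
  unfold Tset
  simp only [mem_filter, mem_univ, true_and, hval]
  split_ifs with h
  · refine prod_eq_one fun l _ => ?_
    simp only [hF, h l]; rfl
  · push Not at h
    obtain ⟨j, hj⟩ := h
    have hij : j ≠ i := by
      rintro rfl
      simp [adj] at hj
    refine prod_eq_zero (i := j) (by simp [hij]) ?_
    simp only [ne_eq, Bool.not_eq_false] at hj
    simp only [hF, hj]; rfl

lemma sum_ind {n k : ℕ} (ω : Omega n k) (π : Equiv.Perm (Fin n)) :
    ∑ i, ind i ω = ((Tset (G1adj ω) (G2adj π ω) π).card : ℝ) := by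
  simp [nb_eq _ ω π]

lemma pigeon {n k : ℕ} (hk : 1 ≤ k) (ω : Omega n k) (π : Equiv.Perm (Fin n)) (t : ℝ)
    (h : k * t ≤ ∑ i, ind i ω) :
    ∃ r : Fin k, t ≤ (TrCard ω.1 (G1adj ω) (G2adj π ω) π r : ℝ) := by
  by_contra hc
  push Not at hc
  rw [sum_ind ω π] at h
  have h1 : (Tset (G1adj ω) (G2adj π ω) π).card =
      ∑ r, TrCard ω.1 (G1adj ω) (G2adj π ω) π r := by
    rw [card_eq_sum_card_fiberwise (f := ω.1) (t := univ) (by simp)]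
    refine sum_congr rfl fun r _ => ?_
    unfold TrCard
    congr 1
    ext x; simp
  rw [h1] at h
  push_cast at h
  have : ∑ r : Fin k, (TrCard ω.1 (G1adj ω) (G2adj π ω) π r : ℝ) < ∑ r : Fin k, t :=
    sum_lt_sum_of_nonempty ⟨⟨0, hk⟩, mem_univ _⟩ fun r _ => hc r
  simp at this
  linarith

lemma Pr_eq {n k : ℕ} (p q s : ℝ) (A : Set (Omega n k)) :
    Pr n k p q s A = EE n k p q s (A.indicator fun _ => 1) := by
  classical
  unfold Pr EE
  refine sum_congr rfl fun ω _ => ?_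
  simp [Set.indicator_apply]

lemma Pr_le_one {n k : ℕ} (hk : 1 ≤ k) {p q s : ℝ} (hp : p ∈ Set.Icc (0 : ℝ) 1)
    (hq : q ∈ Set.Icc (0 : ℝ) 1) (hs : s ∈ Set.Icc (0 : ℝ) 1) (A : Set (Omega n k)) :
    Pr n k p q s A ≤ 1 := by
  classical
  rw [Pr_eq]
  refine le_trans ?_ (EE_one (n := n) hk p q s).le
  refine EE_mono hp hq hs fun ω => ?_
  rw [Set.indicator_apply]; split_ifs <;> norm_num

lemma cheb {n k : ℕ} (hk : 1 ≤ k) {p q s : ℝ} (hp : p ∈ Set.Icc (0 : ℝ) 1)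
    (hq : q ∈ Set.Icc (0 : ℝ) 1) (hs : s ∈ Set.Icc (0 : ℝ) 1) (π : Equiv.Perm (Fin n)) (t m : ℝ)
    (hm : m = n * (((1 - p * s ^ 2) + ((k : ℝ) - 1) * (1 - q * s ^ 2)) / k) ^ (n - 1))
    (hm0 : 0 < m) (ht : k * t ≤ m / 2) :
    1 - 4 / m ^ 2 * (m + n ^ 2 *
      (((1 - p * s ^ 2) ^ 2 + ((k : ℝ) - 1) * (1 - q * s ^ 2) ^ 2) / k) ^ (n - 2) - m ^ 2) ≤
    Pr n k p q s {ω | ∃ r : Fin k, t ≤ (TrCard ω.1 (G1adj ω) (G2adj π ω) π r : ℝ)} := by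
  classical
  rw [Pr_eq]
  set β := (((1 - p * s ^ 2) ^ 2 + ((k : ℝ) - 1) * (1 - q * s ^ 2) ^ 2) / k) with hβ
  have hk' : (1 : ℝ) ≤ k := by exact_mod_cast hk
  have hβ0 : 0 ≤ β := by
    have : 0 ≤ ((k : ℝ) - 1) := by linarith
    positivity
  have key : ∀ ω : Omega n k, 1 - 4 / m ^ 2 * ((∑ i, ∑ j, ind i ω * ind j ω) - 2 * m * (∑ i, ind i ω) + m ^ 2)
      ≤ ({ω : Omega n k | ∃ r : Fin k, t ≤ (TrCard ω.1 (G1adj ω) (G2adj π ω) π r : ℝ)}).indicator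
        (fun _ => (1 : ℝ)) ω := by
    intro ω
    rw [← sum_mul_sum]
    set X := ∑ i, ind i ω with hX
    have e : X * X - 2 * m * X + m ^ 2 = (X - m) ^ 2 := by ring
    rw [e, Set.indicator_apply]
    split_ifs with h
    · have : 0 ≤ 4 / m ^ 2 * (X - m) ^ 2 := by positivity
      linarith
    · have hX2 : X < m / 2 := by
        by_contra hc
        push Not at hc
        exact h (pigeon hk ω π t (ht.trans hc))
      have : 1 ≤ 4 / m ^ 2 * (X - m) ^ 2 := by
        rw [div_mul_eq_mul_div, le_div_iff₀ (by positivity)]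
        nlinarith
      linarith
  refine le_trans ?_ (EE_mono hp hq hs key)
  have lin : EE n k p q s (fun ω => 1 - 4 / m ^ 2 * ((∑ i, ∑ j, ind i ω * ind j ω) - 2 * m * (∑ i, ind i ω) + m ^ 2))
     = EE n k p q s (fun _ => 1) - 4 / m ^ 2 * ((∑ i, ∑ j, EE n k p q s (fun ω => ind i ω * ind j ω))
        - 2 * m * (∑ i, EE n k p q s (ind i)) + m ^ 2 * EE n k p q s (fun _ => 1)) := by
    have a1 : (∑ i, ∑ j, EE n k p q s (fun ω => ind i ω * ind j ω)) =
        EE n k p q s (fun ω => ∑ i, ∑ j, ind i ω * ind j ω) := by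
      unfold EE
      rw [sum_congr rfl fun i _ => sum_comm, sum_comm]
      simp_rw [mul_sum]
    have a2 : (∑ i, EE n k p q s (ind i)) = EE n k p q s (fun ω => ∑ i, ind i ω) := by
      unfold EE
      rw [sum_comm]
      simp_rw [mul_sum]
    rw [a1, a2]
    unfold EE
    rw [mul_sum, mul_sum, ← sum_sub_distrib, ← sum_add_distrib, mul_sum, ← sum_sub_distrib]
    refine sum_congr rfl fun ω _ => ?_
    ring
  rw [lin, EE_one hk]
  have s1 : ∑ i : Fin n, EE n k p q s (ind i) = m := by
    simp_rw [EE_ind hk]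
    simp [hm]
  have s2 : ∑ i : Fin n, ∑ j : Fin n, EE n k p q s (fun ω => ind i ω * ind j ω) ≤ m + n ^ 2 * β ^ (n - 2) := by
    have : ∀ i j : Fin n, EE n k p q s (fun ω => ind i ω * ind j ω) ≤
        (if i = j then EE n k p q s (ind i) else 0) + β ^ (n - 2) := by
      intro i j
      split_ifs with h
      · subst h
        have : (fun ω : Omega n k => ind i ω * ind i ω) = ind i := by
          funext ω
          rw [nb_eq i ω π]; split_ifs <;> simp
        rw [this]
        have : 0 ≤ β ^ (n - 2) := by positivity
        linarith
      · rw [zero_add]; exact EE_pair hk hp hq hs i j h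
    refine (sum_le_sum fun i _ => sum_le_sum fun j _ => this i j).trans (le_of_eq ?_)
    simp only [sum_add_distrib, sum_ite_eq, mem_univ, if_true, s1]
    simp; ring
  rw [s1]
  have : 0 ≤ 4 / m ^ 2 := by positivity
  have := mul_le_mul_of_nonneg_left s2 this
  linarith

lemma one_sub_ge {x : ℝ} (h0 : 0 ≤ x) (h1 : x ≤ 1 / 2) : Real.exp (-x - 2 * x ^ 2) ≤ 1 - x := by
  have hp : 0 < 1 - x := by linarith
  rw [← Real.le_log_iff_exp_le hp]
  refine le_trans ?_ (Real.one_sub_inv_le_log_of_pos hp)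
  have : (1 - x)⁻¹ ≤ 1 + x + 2 * x ^ 2 := by
    rw [inv_le_iff_one_le_mul₀ hp]
    nlinarith [mul_nonneg h0 h0]
  linarith

set_option maxHeartbeats 2000000 in
/-- quantitative bound -/
lemma quant {n k : ℕ} (hn : 2 ≤ n) (hk : 1 ≤ k) {p q s ε κ : ℝ} (hp : p ∈ Set.Icc (0 : ℝ) 1)
    (hq : q ∈ Set.Icc (0 : ℝ) 1) (hs : s ∈ Set.Icc (0 : ℝ) 1) (π : Equiv.Perm (Fin n)) (t : ℝ)
    (hε : ε ∈ Set.Ioo (0 : ℝ) 1)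
    (hdeg : n * s ^ 2 * (p + ((k : ℝ) - 1) * q) / k < (1 - ε) * Real.log n)
    (hl : Real.log n / n ≤ 1 / 2) (hκ : (k : ℝ) ≤ κ)
    (hl2 : 2 * Real.log n / n ≤ ε / 2)
    (ht : k * t ≤ (n : ℝ) ^ (ε / 2) / 2) :
    1 - 4 * ((n : ℝ) ^ (-(ε / 2)) + Real.exp (2 * (Real.log n / n) + 5 * κ * (Real.log n ^ 2 / n)) - 1) ≤
    Pr n k p q s {ω | ∃ r : Fin k, t ≤ (TrCard ω.1 (G1adj ω) (G2adj π ω) π r : ℝ)} := by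
  have hk' : (1 : ℝ) ≤ k := by exact_mod_cast hk
  have hn' : (2 : ℝ) ≤ n := by exact_mod_cast hn
  have hL : 0 ≤ Real.log n := Real.log_nonneg (by linarith)
  set P := p * s ^ 2 with hP
  set Q := q * s ^ 2 with hQ
  have hP0 : 0 ≤ P := mul_nonneg hp.1 (sq_nonneg _)
  have hQ0 : 0 ≤ Q := mul_nonneg hq.1 (sq_nonneg _)
  set x := (P + ((k : ℝ) - 1) * Q) / k with hx
  have hx0 : 0 ≤ x := div_nonneg (add_nonneg hP0 (mul_nonneg (by linarith) hQ0)) (by linarith)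
  have hxn : n * x < (1 - ε) * Real.log n := by
    refine lt_of_eq_of_lt ?_ hdeg
    rw [hx, hP, hQ]; ring
  have hn0 : (0 : ℝ) < n := by linarith
  have hxL : x ≤ Real.log n / n := by
    rw [le_div_iff₀ hn0]; nlinarith [hε.1]
  have hx2 : x ≤ 1 / 2 := hxL.trans hl
  have hnx2 : n * x ^ 2 ≤ Real.log n ^ 2 / n := by
    have : x ^ 2 ≤ (Real.log n / n) ^ 2 := pow_le_pow_left₀ hx0 hxL 2
    calc n * x ^ 2 ≤ n * (Real.log n / n) ^ 2 := by gcongr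
      _ = _ := by field_simp
  have hμ : ((1 - P) + ((k : ℝ) - 1) * (1 - Q)) / k = 1 - x := by
    rw [hx]; field_simp; ring
  have hβ : ((1 - P) ^ 2 + ((k : ℝ) - 1) * (1 - Q) ^ 2) / k ≤ 1 - 2 * x + k * x ^ 2 := by
    have e : 1 - 2 * x + k * x ^ 2 - ((1 - P) ^ 2 + ((k : ℝ) - 1) * (1 - Q) ^ 2) / k =
        ((P + ((k : ℝ) - 1) * Q) ^ 2 - (P ^ 2 + ((k : ℝ) - 1) * Q ^ 2)) / k := by
      rw [hx]; field_simp; ring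
    have h2 : 0 ≤ ((k : ℝ) - 1) * ((k : ℝ) - 2) := by
      rcases Nat.lt_or_ge k 2 with h | h
      · have : k = 1 := by omega
        simp [this]
      · have : (2 : ℝ) ≤ k := by exact_mod_cast h
        exact mul_nonneg (by linarith) (by linarith)
    have : 0 ≤ ((P + ((k : ℝ) - 1) * Q) ^ 2 - (P ^ 2 + ((k : ℝ) - 1) * Q ^ 2)) / k := by
      refine div_nonneg ?_ (by linarith)
      have : ((P + ((k : ℝ) - 1) * Q) ^ 2 - (P ^ 2 + ((k : ℝ) - 1) * Q ^ 2)) =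
        2 * (P * Q * ((k : ℝ) - 1)) + ((k : ℝ) - 1) * ((k : ℝ) - 2) * Q ^ 2 := by ring
      rw [this]
      have : 0 ≤ (k : ℝ) - 1 := by linarith
      positivity
    linarith
  set β := ((1 - P) ^ 2 + ((k : ℝ) - 1) * (1 - Q) ^ 2) / k with hβd
  have hβ0 : 0 ≤ β := by
    have : 0 ≤ (k : ℝ) - 1 := by linarith
    positivity
  have hμ0 : 0 < 1 - x := by linarith
  have hge := one_sub_ge hx0 hx2
  set m := n * (1 - x) ^ (n - 1) with hm
  have hm0 : 0 < m := by positivity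
  have hmge : (n : ℝ) ^ (ε / 2) ≤ m := by
    have h1 : Real.exp (n * (-x - 2 * x ^ 2)) ≤ (1 - x) ^ (n - 1) := by
      rw [Real.exp_nat_mul]
      calc _ ≤ (1 - x) ^ n := pow_le_pow_left₀ (Real.exp_pos _).le hge n
        _ ≤ _ := pow_le_pow_of_le_one hμ0.le (by linarith) (by omega)
    have h2 : Real.exp (Real.log n + n * (-x - 2 * x ^ 2)) ≤ m := by
      rw [Real.exp_add, Real.exp_log hn0]
      exact mul_le_mul_of_nonneg_left h1 hn0.le
    refine le_trans ?_ h2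
    rw [Real.rpow_def_of_pos hn0, Real.exp_le_exp]
    have h3 : 2 * (Real.log n ^ 2 / n) ≤ ε / 2 * Real.log n := by
      have := mul_le_mul_of_nonneg_right hl2 hL
      calc _ = 2 * Real.log n / n * Real.log n := by ring
        _ ≤ _ := this
    nlinarith
  have hch := cheb hk hp hq hs π t m (by rw [hm, ← hP, ← hQ, hμ]) hm0 (ht.trans (by linarith))
  rw [← hP, ← hQ, ← hβd] at hch
  refine le_trans ?_ hch
  set R := Real.exp (2 * (Real.log n / n) + 5 * κ * (Real.log n ^ 2 / n)) with hR
  have hratio : β ^ (n - 2) ≤ R * ((1 - x) ^ (n - 1)) ^ 2 := by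
    have b1 : β ^ (n - 2) ≤ Real.exp ((n - 2 : ℕ) * (-2 * x + k * x ^ 2)) := by
      rw [Real.exp_nat_mul]
      refine pow_le_pow_left₀ hβ0 (hβ.trans ?_) _
      linarith [Real.add_one_le_exp (-2 * x + k * x ^ 2)]
    have b2 : Real.exp ((2 * (n - 1) : ℕ) * (-x - 2 * x ^ 2)) ≤ ((1 - x) ^ (n - 1)) ^ 2 := by
      rw [Real.exp_nat_mul, ← pow_mul, mul_comm (n - 1) 2]
      exact pow_le_pow_left₀ (Real.exp_pos _).le hge _
    refine b1.trans (le_trans ?_ (mul_le_mul_of_nonneg_left b2 (Real.exp_pos _).le))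
    rw [hR, ← Real.exp_add, Real.exp_le_exp]
    push_cast [hn, (by omega : 1 ≤ n)]
    have c1 : k * (n * x ^ 2) ≤ κ * (Real.log n ^ 2 / n) :=
      mul_le_mul hκ hnx2 (by positivity) (by linarith)
    have c2 : n * x ^ 2 ≤ k * (n * x ^ 2) := le_mul_of_one_le_left (by positivity) hk'
    have c3 : 0 ≤ k * x ^ 2 := by positivity
    nlinarith [sq_nonneg x]
  have hfin : 4 / m ^ 2 * (m + n ^ 2 * β ^ (n - 2) - m ^ 2) ≤ 4 * ((n : ℝ) ^ (-(ε / 2)) + R - 1) := by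
    have d1 : n ^ 2 * β ^ (n - 2) ≤ R * m ^ 2 := by
      calc n ^ 2 * β ^ (n - 2) ≤ n ^ 2 * (R * ((1 - x) ^ (n - 1)) ^ 2) := by gcongr
        _ = _ := by rw [hm]; ring
    have d2 : 1 / m ≤ (n : ℝ) ^ (-(ε / 2)) := by
      rw [Real.rpow_neg hn0.le, ← one_div]
      exact one_div_le_one_div_of_le (by positivity) hmge
    have d3 : 4 / m ^ 2 * (m + n ^ 2 * β ^ (n - 2) - m ^ 2) ≤ 4 / m ^ 2 * (m + R * m ^ 2 - m ^ 2) := by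
      gcongr
    have d4 : 4 / m ^ 2 * (m + R * m ^ 2 - m ^ 2) = 4 * (1 / m + R - 1) := by
      field_simp
    linarith
  linarith

/-- Lemma `lem:T bound`.
If `n s² (p+(k-1)q)/k < (1-ε) log n` and `p s² = o(1)`, then there are constants
`δ > γ > 0` such that, provided `k = o(n^{δ-γ})`,
`min_{π ∈ S_n} P_π(|T_r^π| ≥ n^γ/2 for some r) → 1`,
where `P_π` is the law of the model with ground truth `π⋆ = π`. -/
theorem T_bound
    (p q s : ℕ → ℝ) (k : ℕ → ℕ)
    (hp01 : ∀ n, p n ∈ Set.Icc (0 : ℝ) 1) (hq01 : ∀ n, q n ∈ Set.Icc (0 : ℝ) 1)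
    (hs01 : ∀ n, s n ∈ Set.Icc (0 : ℝ) 1) (hk1 : ∀ n, 1 ≤ k n)
    (ε : ℝ) (hε : ε ∈ Set.Ioo (0 : ℝ) 1)
    (hdeg : ∀ᶠ n : ℕ in atTop,
        n * s n ^ 2 * (p n + ((k n : ℝ) - 1) * q n) / k n < (1 - ε) * Real.log n)
    (hps : Tendsto (fun n : ℕ => p n * s n ^ 2) atTop (nhds 0)) :
    ∃ δ γ : ℝ, 0 < γ ∧ γ < δ ∧
      (Tendsto (fun n : ℕ => (k n : ℝ) / (n : ℝ) ^ (δ - γ)) atTop (nhds 0) →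
        Tendsto (fun n : ℕ =>
            ⨅ π : Equiv.Perm (Fin n),
              Pr n (k n) (p n) (q n) (s n)
                {ω | ∃ r : Fin (k n),
                    (n : ℝ) ^ γ / 2 ≤ (TrCard ω.1 (G1adj ω) (G2adj π ω) π r : ℝ)})
          atTop (nhds 1)) := by
  have hε0 := hε.1
  have hε1 := hε.2
  refine ⟨ε / 2, ε / 4, by linarith, by linarith, fun hk => ?_⟩
  have hcast : Tendsto (fun n : ℕ => (n : ℝ)) atTop atTop := tendsto_natCast_atTop_atTop
  have hlog : Tendsto (fun n : ℕ => Real.log n / n) atTop (nhds 0) :=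
    (Real.isLittleO_log_id_atTop.tendsto_div_nhds_zero).comp hcast
  have hlog4 : Tendsto (fun n : ℕ => Real.log n / (n : ℝ) ^ (1 / 4 : ℝ)) atTop (nhds 0) :=
    ((isLittleO_log_rpow_atTop (by norm_num : (0 : ℝ) < 1 / 4)).tendsto_div_nhds_zero).comp hcast
  have hκ : Tendsto (fun n : ℕ => 5 * (n : ℝ) ^ (1 / 2 : ℝ) * (Real.log n ^ 2 / n)) atTop (nhds 0) := by
    have h1 := (hlog4.pow 2).const_mul 5
    simp only [ne_eq, OfNat.ofNat_ne_zero, not_false_eq_true, zero_pow, mul_zero] at h1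
    refine h1.congr' ?_
    filter_upwards [eventually_gt_atTop 0] with n hn
    have hn0 : (0 : ℝ) < n := by exact_mod_cast hn
    have e : (n : ℝ) = (n : ℝ) ^ (1 / 2 : ℝ) * ((n : ℝ) ^ (1 / 4 : ℝ)) ^ 2 := by
      rw [← Real.rpow_natCast, ← Real.rpow_mul hn0.le, ← Real.rpow_add hn0]
      norm_num
    have hA : 0 < (n : ℝ) ^ (1 / 2 : ℝ) := by positivity
    have hB : 0 < (n : ℝ) ^ (1 / 4 : ℝ) := by positivity
    generalize (n : ℝ) ^ (1 / 2 : ℝ) = a at *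
    generalize (n : ℝ) ^ (1 / 4 : ℝ) = b at *
    have e2 : Real.log n ^ 2 / n = Real.log n ^ 2 / (a * b ^ 2) := by
      congr 1
    rw [e2]
    field_simp
  have hr : Tendsto (fun n : ℕ => 1 - 4 * ((n : ℝ) ^ (-(ε / 2)) + Real.exp (2 * (Real.log n / n)
      + 5 * (n : ℝ) ^ (1 / 2 : ℝ) * (Real.log n ^ 2 / n)) - 1)) atTop (nhds 1) := by
    have h1 : Tendsto (fun n : ℕ => (n : ℝ) ^ (-(ε / 2))) atTop (nhds 0) :=
      (tendsto_rpow_neg_atTop (by linarith : 0 < ε / 2)).comp hcast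
    have h2 := (Real.continuous_exp.tendsto _).comp ((hlog.const_mul 2).add hκ)
    have h3 := (((h1.add h2).sub_const 1).const_mul 4).const_sub 1
    simpa using h3
  refine tendsto_of_tendsto_of_tendsto_of_le_of_le' hr tendsto_const_nhds ?_ ?_
  · filter_upwards [hdeg, eventually_ge_atTop 2, hlog.eventually_le_const (by norm_num : (0 : ℝ) < 1 / 2),
      hlog.eventually_le_const (by linarith : 0 < ε / 4), hk.eventually_le_const zero_lt_one]
      with n h1 h2 h3 h4 h5
    have hn' : (2 : ℝ) ≤ n := by exact_mod_cast h2
    have hn0 : (0 : ℝ) < n := by linarith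
    have h6 : (k n : ℝ) ≤ (n : ℝ) ^ (ε / 2 - ε / 4) := by
      rwa [div_le_one (by positivity)] at h5
    refine le_ciInf fun π => ?_
    refine quant h2 (hk1 n) (hp01 n) (hq01 n) (hs01 n) π _ hε h1 h3 ?_ ?_ ?_
    · exact h6.trans (Real.rpow_le_rpow_of_exponent_le (by linarith) (by linarith))
    · rw [mul_div_assoc]; linarith
    · calc (k n : ℝ) * ((n : ℝ) ^ (ε / 4) / 2) ≤
          (n : ℝ) ^ (ε / 2 - ε / 4) * ((n : ℝ) ^ (ε / 4) / 2) := by gcongr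
        _ = (n : ℝ) ^ (ε / 2) / 2 := by
          rw [← mul_div_assoc, ← Real.rpow_add hn0]; congr 2; ring
  · filter_upwards with n
    exact (ciInf_le (Set.finite_range _).bddBelow (Equiv.refl _)).trans
      (Pr_le_one (hk1 n) (hp01 n) (hq01 n) (hs01 n) _)

end CSBM
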